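/- arXiv:0704.1341 — 2 statements merged into one kernel-verified Lean document; each statement's English description precedes it below -/
import Mathlib

section
/- The improper integral identity ∫_0^1 ((1+e^{-2t})/(1-e^{-2t}) - 1/t) dt/t + ∫_1^∞ (2e^{-2t}/(1-e^{-2t})) dt/t = 1 - log π - Γ'(1) holds, where Γ'(1) = -γ is the derivative of the Gamma function at 1. -/
open Real Filter Topology MeasureTheory Set in
/-- the inverse tangent integral -/
noncomputable def atI (x : ℝ) : ℝ := ∫ u in (0:ℝ)..x, dslope arctan 0 u

open Real Filter Topology MeasureTheory Set in
theorem cont_ds : Continuous (dslope arctan 0) := by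
  rw [← continuousOn_univ]
  exact (continuousOn_dslope univ_mem).2
    ⟨Real.continuous_arctan.continuousOn, Real.differentiable_arctan 0⟩

open Real Filter Topology MeasureTheory Set in
theorem ds_eq {x : ℝ} (hx : x ≠ 0) : dslope arctan 0 x = arctan x / x := by
  rw [dslope_of_ne _ hx, slope_def_field]; simp

open Real Filter Topology MeasureTheory Set in
theorem atI_zero : atI 0 = 0 := by simp [atI]

open Real Filter Topology MeasureTheory Set in
theorem atI_deriv (x : ℝ) : HasDerivAt atI (dslope arctan 0 x) x :=
  intervalIntegral.integral_hasDerivAt_right (cont_ds.intervalIntegrable _ _)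
    (cont_ds.stronglyMeasurableAtFilter _ _) cont_ds.continuousAt

open Real Filter Topology MeasureTheory Set in
theorem atI_cont : Continuous atI :=
  continuous_iff_continuousAt.2 fun x => (atI_deriv x).continuousAt

open Real Filter Topology MeasureTheory Set in
theorem atI_scale {c x : ℝ} (hc : 0 < c) (hx : 0 < x) :
    HasDerivAt (fun t => atI (t / c)) (arctan (x / c) / x) x := by
  have h := (atI_deriv (x / c)).comp x ((hasDerivAt_id x).div_const c)
  rw [ds_eq (by positivity)] at h
  refine HasDerivAt.congr_deriv h ?_
  field_simp

open Real Filter Topology MeasureTheory Set in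
theorem atI_inv {T : ℝ} (hT : 0 < T) : atI T = atI T⁻¹ + π / 2 * log T := by
  have hd : ∀ x ∈ Ioi (0:ℝ),
      HasDerivAt (fun t => atI t - atI t⁻¹ - π / 2 * log t) 0 x := by
    intro x hx
    have hx : 0 < x := hx
    have h1 := atI_deriv x
    have h2 := (atI_deriv x⁻¹).comp x (hasDerivAt_inv hx.ne')
    have h3 := (Real.hasDerivAt_log hx.ne').const_mul (π / 2)
    have h := (h1.sub h2).sub h3
    rw [ds_eq hx.ne', ds_eq (by positivity), arctan_inv_of_pos hx] at h
    refine HasDerivAt.congr_deriv h ?_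
    field_simp
    ring
  have hconst := (convex_Ioi (0:ℝ)).is_const_of_fderivWithin_eq_zero (𝕜 := ℝ)
    (f := fun t => atI t - atI t⁻¹ - π / 2 * log t)
    (fun x hx => (hd x hx).differentiableAt.differentiableWithinAt)
    (fun x hx => by
      have := (hd x hx).hasFDerivAt.hasFDerivWithinAt (s := Ioi 0)
      rw [this.fderivWithin ((isOpen_Ioi).uniqueDiffWithinAt hx)]
      ext; simp)
    (mem_Ioi.2 hT) (mem_Ioi.2 one_pos)
  simp at hconst
  linarith

open Real Filter Topology MeasureTheory Set in
theorem atI_lim {c : ℝ} (hc : 0 < c) :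
    Tendsto (fun t => atI (t / c) - π / 2 * log t) atTop (𝓝 (- (π / 2 * log c))) := by
  have h1 : Tendsto (fun t : ℝ => atI (c / t)) atTop (𝓝 0) := by
    have := (atI_cont.tendsto 0).comp (tendsto_const_nhds (x := c).div_atTop tendsto_id)
    rwa [atI_zero] at this
  have h2 := h1.add_const (-(π / 2 * log c))
  rw [zero_add] at h2
  refine h2.congr' ?_
  filter_upwards [eventually_gt_atTop 0] with t ht
  rw [atI_inv (by positivity : 0 < t / c), log_div ht.ne' hc.ne', inv_div]
  ring

open Real Filter Topology MeasureTheory Set in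
/-- the terms of the series -/
noncomputable def hT (n : ℕ) (t : ℝ) : ℝ :=
  2 / (t ^ 2 + (π * (n + 1)) ^ 2)
    - 2 / π * (arctan (t / (π * (n + 1))) / t - arctan (t / (π * (n + 2))) / t)

open Real Filter Topology MeasureTheory Set in
theorem arctan_le {x y : ℝ} (hx : 0 ≤ x) (hxy : x ≤ y) :
    arctan y - arctan x ≤ (y - x) / (1 + x ^ 2) := by
  have := (convex_Ici x).image_sub_le_mul_sub_of_deriv_le (f := arctan) (C := 1 / (1 + x ^ 2))
    Real.continuous_arctan.continuousOn Real.differentiable_arctan.differentiableOn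
    (fun z hz => by
      rw [interior_Ici] at hz
      have hz : x < z := hz
      rw [Real.deriv_arctan]
      have : x ^ 2 ≤ z ^ 2 := by gcongr
      exact one_div_le_one_div_of_le (by positivity) (by linarith)) x self_mem_Ici y hxy hxy
  rw [div_eq_mul_one_div, mul_comm]; exact this

open Real Filter Topology MeasureTheory Set in
theorem hT_nonneg (n : ℕ) {t : ℝ} (ht : 0 < t) : 0 ≤ hT n t := by
  have h := arctan_le (x := π * (n + 1) / t) (y := π * (n + 2) / t) (by positivity)
    (by gcongr; norm_num)
  have e1 : arctan (t / (π * (n + 1))) = π / 2 - arctan (π * (n + 1) / t) := by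
    rw [← arctan_inv_of_pos (by positivity), inv_div]
  have e2 : arctan (t / (π * (n + 2))) = π / 2 - arctan (π * (n + 2) / t) := by
    rw [← arctan_inv_of_pos (by positivity), inv_div]
  rw [hT, e1, e2, sub_nonneg]
  calc _ = 2 / (π * t) * (arctan (π * (n + 2) / t) - arctan (π * (n + 1) / t)) := by
        field_simp; ring
    _ ≤ 2 / (π * t) * ((π * (n + 2) / t - π * (n + 1) / t) / (1 + (π * (n + 1) / t) ^ 2)) := by
        gcongr
    _ = _ := by field_simp; ring

open Real Filter Topology MeasureTheory Set in
noncomputable def hG (n : ℕ) (t : ℝ) : ℝ :=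
  2 / (π * (n + 1)) * arctan (t / (π * (n + 1)))
    - 2 / π * (atI (t / (π * (n + 1))) - atI (t / (π * (n + 2))))

open Real Filter Topology MeasureTheory Set in
theorem hG_cont (n : ℕ) : Continuous (hG n) := by
  have := atI_cont
  have := Real.continuous_arctan
  unfold hG
  fun_prop

open Real Filter Topology MeasureTheory Set in
theorem hG_deriv (n : ℕ) {t : ℝ} (ht : 0 < t) : HasDerivAt (hG n) (hT n t) t := by
  have h1 := (((hasDerivAt_id t).div_const (π * (n + 1))).arctan).const_mul (2 / (π * (n + 1)))
  have h2 := ((atI_scale (c := π * (n + 1)) (by positivity) ht).sub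
    (atI_scale (c := π * (n + 2)) (by positivity) ht)).const_mul (2 / π)
  refine HasDerivAt.congr_deriv (h1.sub h2) ?_
  rw [hT]
  congr 1
  simp only [id]
  field_simp
  ring

open Real Filter Topology MeasureTheory Set in
theorem hG_lim (n : ℕ) :
    Tendsto (hG n) atTop (𝓝 (1 / ((n:ℝ) + 1) - (log (n + 2) - log (n + 1)))) := by
  have h0 : Tendsto (fun t : ℝ => arctan (t / (π * (n + 1)))) atTop (𝓝 (π / 2)) :=
    (tendsto_nhds_of_tendsto_nhdsWithin tendsto_arctan_atTop).comp
      (tendsto_id.atTop_div_const (by positivity))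
  have h1 := h0.const_mul (2 / (π * (n + 1)))
  have h2 := ((atI_lim (c := π * (n + 1)) (by positivity)).sub
    (atI_lim (c := π * (n + 2)) (by positivity))).const_mul (2 / π)
  have h := h1.sub h2
  convert h using 1
  · ext t; rw [hG]; ring
  · congr 1
    rw [log_mul (by positivity) (by positivity), log_mul (by positivity) (by positivity)]
    field_simp
    ring

open Real Filter Topology MeasureTheory Set in
theorem hT_integrable (n : ℕ) : IntegrableOn (hT n) (Ioi 0) :=
  integrableOn_Ioi_deriv_of_nonneg (hG_cont n).continuousWithinAt
    (fun _ hx => hG_deriv n hx) (fun _ hx => hT_nonneg n hx) (hG_lim n)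

open Real Filter Topology MeasureTheory Set in
theorem hT_integral (n : ℕ) :
    ∫ t in Ioi 0, hT n t = 1 / ((n:ℝ) + 1) - (log (n + 2) - log (n + 1)) := by
  rw [integral_Ioi_of_hasDerivAt_of_nonneg (hG_cont n).continuousWithinAt
    (fun _ hx => hG_deriv n hx) (fun _ hx => hT_nonneg n hx) (hG_lim n)]
  simp [hG, atI_zero]

open Real Filter Topology MeasureTheory Set in
theorem gamma_sum :
    HasSum (fun n : ℕ => 1 / ((n:ℝ) + 1) - (log (n + 2) - log (n + 1)))
      eulerMascheroniConstant := by
  rw [hasSum_iff_tendsto_nat_of_nonneg]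
  · refine tendsto_eulerMascheroniSeq.congr fun n => ?_
    induction n with
    | zero => simp [eulerMascheroniSeq]
    | succ n ih =>
      rw [Finset.sum_range_succ, ← ih, eulerMascheroniSeq, eulerMascheroniSeq, harmonic_succ]
      push_cast
      rw [show (n:ℝ) + 1 + 1 = n + 2 by ring]
      ring
  · intro n
    rw [← hT_integral n]
    exact setIntegral_nonneg measurableSet_Ioi fun t ht => hT_nonneg n ht

open Real Filter Topology MeasureTheory Set in
theorem coth_sum {t : ℝ} (ht : 0 < t) :
    HasSum (fun n : ℕ => 2 / (t ^ 2 + (π * ((n:ℝ) + 1)) ^ 2))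
      (((1 + exp (-2*t)) / (1 - exp (-2*t)) - 1/t) / t) := by
  have hpi : (π : ℂ) ≠ 0 := by exact_mod_cast pi_ne_zero
  have htc : (t : ℂ) ≠ 0 := by exact_mod_cast ht.ne'
  set x : ℂ := Complex.I * (t / π) with hxdef
  have hx : x ∈ Complex.integerComplement := by
    rw [Complex.mem_integerComplement_iff]
    rintro ⟨n, hn⟩
    have := congrArg Complex.im hn
    rw [hxdef, ← Complex.ofReal_div] at this
    simp only [Complex.intCast_im, Complex.I_mul_im, Complex.ofReal_re] at this
    have h2 : 0 < t / π := by positivity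
    exact h2.ne (by simpa using this)
  have hs := (summable_cotTerm hx).hasSum
  have hv : ∑' n, cotTerm x n = _ := (cot_series_rep' hx).symm
  rw [hv] at hs
  have hs2 := hs.mul_left (Complex.I / (π * t))
  have hexp : 1 - exp (-2*t) ≠ 0 := by
    have : exp (-2*t) < 1 := by rw [← Real.exp_zero]; exact Real.exp_lt_exp.2 (by linarith)
    linarith
  rw [← Complex.hasSum_ofReal]
  refine (congrArg (fun f => HasSum f _) (funext fun n => ?_)).mpr (?_ : HasSum (fun i => Complex.I / (π * t) * cotTerm x i) _)
  · rw [cotTerm_identity hx]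
    have e : (x + (n + 1)) * (x - (n + 1)) = - ((t^2 + (π * (n+1))^2) / π^2) := by
      rw [hxdef]
      field_simp
      ring_nf
      rw [Complex.I_sq]
      ring
    have hne : ((t:ℂ)^2 + (π * (n+1))^2) ≠ 0 := by
      have : (t^2 + (π * (n+1))^2 : ℝ) ≠ 0 := by positivity
      exact_mod_cast this
    rw [e, hxdef]
    push_cast
    field_simp
    rw [Complex.I_sq]
    ring
  · have hc : Complex.cot (π * x) = - Complex.I * ((1 + exp (-2*t)) / (1 - exp (-2*t)) : ℝ) := by
      rw [Complex.cot_eq_exp_ratio]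
      have e1 : 2 * Complex.I * (π * x) = ((-2*t : ℝ) : ℂ) := by
        rw [hxdef]; field_simp; rw [Complex.I_sq]; push_cast; ring
      rw [e1, ← Complex.ofReal_exp]
      have hexp' : (1 - (exp (-2*t) : ℝ) : ℂ) ≠ 0 := by exact_mod_cast hexp
      push_cast at hexp' ⊢
      field_simp
      rw [Complex.I_sq]
      ring
    refine (congrArg (HasSum _) ?_).mpr hs2
    rw [hc, hxdef]
    push_cast
    field_simp
    ring_nf
    simp only [Complex.I_sq]
    ring

open Real Filter Topology MeasureTheory Set in
theorem tele_sum {t : ℝ} (ht : 0 < t) :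
    HasSum (fun n : ℕ => 2 / π * (arctan (t / (π * ((n:ℝ) + 1))) / t
      - arctan (t / (π * (n + 2))) / t)) (2 / π * (arctan (t / π) / t)) := by
  refine HasSum.mul_left _ ?_
  rw [hasSum_iff_tendsto_nat_of_nonneg]
  · have h0 : Tendsto (fun n : ℕ => arctan (t / (π * ((n:ℝ) + 1)))) atTop (𝓝 0) := by
      have h1 : Tendsto (fun n : ℕ => t / (π * ((n:ℝ) + 1))) atTop (𝓝 0) :=
        tendsto_const_nhds.div_atTop
          ((tendsto_natCast_atTop_atTop.atTop_add tendsto_const_nhds).const_mul_atTop pi_pos)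
      simpa [Function.comp_def] using (Real.continuous_arctan.tendsto 0).comp h1
    have h := (h0.div_const t).const_sub (arctan (t / π) / t)
    simp only [zero_div, sub_zero] at h
    refine h.congr fun n => ?_
    induction n with
    | zero => simp
    | succ n ih =>
      rw [Finset.sum_range_succ, ← ih]
      push_cast
      rw [show (n:ℝ) + 1 + 1 = n + 2 by ring]
      ring
  · intro n
    rw [sub_nonneg]
    gcongr
    norm_num

open Real Filter Topology MeasureTheory Set in
/-- the difference function -/
noncomputable def hD (t : ℝ) : ℝ :=
  ((1 + exp (-2*t)) / (1 - exp (-2*t)) - 1/t) / t - 2 / π * (arctan (t / π) / t)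

open Real Filter Topology MeasureTheory Set in
theorem hD_integral : ∫ t in Ioi 0, hD t = eulerMascheroniConstant := by
  have hn : ∀ n, ∫ t in Ioi 0, ‖hT n t‖ = 1 / ((n:ℝ) + 1) - (log (n + 2) - log (n + 1)) := by
    intro n
    rw [← hT_integral n]
    exact setIntegral_congr_fun measurableSet_Ioi fun t ht => norm_of_nonneg (hT_nonneg n ht)
  have h := hasSum_integral_of_summable_integral_norm (μ := volume.restrict (Ioi 0))
    (F := hT) hT_integrable (by simp_rw [hn]; exact gamma_sum.summable)
  simp_rw [hT_integral] at h
  rw [← h.unique gamma_sum]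
  exact setIntegral_congr_fun measurableSet_Ioi fun t ht =>
    ((coth_sum ht).sub (tele_sum ht)).tsum_eq.symm

open Real Filter Topology MeasureTheory Set in
theorem hD_integrable : IntegrableOn hD (Ioi 0) := by
  by_contra h
  have h1 := integral_undef h
  rw [hD_integral] at h1
  linarith [one_half_lt_eulerMascheroniConstant]

open Real Filter Topology MeasureTheory Set in
theorem c_int : IntegrableOn (fun t => 2 / π * (arctan (t / π) / t)) (Ioc 0 1) ∧
    ∫ t in Ioc (0:ℝ) 1, 2 / π * (arctan (t / π) / t) = 2 / π * atI (1 / π) := by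
  have hc : Continuous fun t : ℝ => 2 / π * (dslope arctan 0 (t / π) * (1 / π)) := by
    have := cont_ds
    fun_prop
  have he : EqOn (fun t : ℝ => 2 / π * (dslope arctan 0 (t / π) * (1 / π)))
      (fun t => 2 / π * (arctan (t / π) / t)) (Ioc 0 1) := by
    intro t ht
    have := ht.1
    simp only
    rw [ds_eq (by positivity)]
    field_simp
  constructor
  · exact ((hc.integrableOn_Icc (a := 0) (b := 1)).mono_set Ioc_subset_Icc_self).congr_fun he
      measurableSet_Ioc
  · rw [← setIntegral_congr_fun measurableSet_Ioc he,
      ← intervalIntegral.integral_of_le zero_le_one,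
      intervalIntegral.integral_eq_sub_of_hasDerivAt (f := fun t => 2 / π * atI (t / π))
        (fun t _ => ((atI_deriv (t / π)).comp t ((hasDerivAt_id t).div_const π)).const_mul _)
        (hc.intervalIntegrable _ _)]
    simp [atI_zero]

open Real Filter Topology MeasureTheory Set in
theorem c_int2 : IntegrableOn (fun t => 2 / π * (arctan (t / π) / t) - 1 / t) (Ioi 1) ∧
    ∫ t in Ioi (1:ℝ), (2 / π * (arctan (t / π) / t) - 1 / t)
      = - log π - 2 / π * atI (1 / π) := by
  have hd : ∀ t ∈ Ici (1:ℝ), HasDerivAt (fun t => 2 / π * atI (t / π) - log t)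
      (2 / π * (arctan (t / π) / t) - 1 / t) t := by
    intro t ht
    have ht : 0 < t := lt_of_lt_of_le one_pos ht
    rw [one_div]
    exact ((atI_scale pi_pos ht).const_mul _).sub (Real.hasDerivAt_log ht.ne')
  have hneg : ∀ t ∈ Ioi (1:ℝ), 2 / π * (arctan (t / π) / t) - 1 / t ≤ 0 := by
    intro t ht
    have ht : 0 < t := lt_trans one_pos ht
    rw [sub_nonpos]
    calc _ ≤ 2 / π * ((π / 2) / t) := by
          gcongr
          exact (arctan_lt_pi_div_two _).le
      _ = _ := by field_simp
  have hl : Tendsto (fun t => 2 / π * atI (t / π) - log t) atTop (𝓝 (- log π)) := by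
    have h := (atI_lim pi_pos).const_mul (2 / π)
    convert h using 1
    · ext t; field_simp
    · congr 1; field_simp
  refine ⟨integrableOn_Ioi_deriv_of_nonpos' hd hneg hl, ?_⟩
  rw [integral_Ioi_of_hasDerivAt_of_nonpos' hd hneg hl]
  simp

open Real Filter Topology MeasureTheory Set in
theorem sq_int : IntegrableOn (fun t : ℝ => 1 / t ^ 2) (Ioi 1) ∧
    ∫ t in Ioi (1:ℝ), 1 / t ^ 2 = 1 := by
  have hd : ∀ t ∈ Ici (1:ℝ), HasDerivAt (fun t : ℝ => - t⁻¹) (1 / t ^ 2) t := by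
    intro t ht
    have ht : 0 < t := lt_of_lt_of_le one_pos ht
    refine HasDerivAt.congr_deriv (hasDerivAt_inv ht.ne').neg ?_
    field_simp
  have hp : ∀ t ∈ Ioi (1:ℝ), 0 ≤ 1 / t ^ 2 := fun t _ => by positivity
  have hl : Tendsto (fun t : ℝ => - t⁻¹) atTop (𝓝 0) := by
    simpa using tendsto_inv_atTop_zero.neg (G := ℝ)
  refine ⟨integrableOn_Ioi_deriv_of_nonneg' hd hp hl, ?_⟩
  rw [integral_Ioi_of_hasDerivAt_of_nonneg' hd hp hl]
  simp

/-- the integral identity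
∫_0^1 ((1+e^{-2t})/(1-e^{-2t}) - 1/t) dt/t + ∫_1^∞ (2e^{-2t}/(1-e^{-2t})) dt/t
  = 1 - log π - Γ'(1). -/
theorem stmt_5 :
    (∫ t in Set.Ioc (0:ℝ) 1,
        ((1 + Real.exp (-2*t)) / (1 - Real.exp (-2*t)) - 1/t) / t)
      + (∫ t in Set.Ioi (1:ℝ),
          (2 * Real.exp (-2*t) / (1 - Real.exp (-2*t))) / t)
      = 1 - Real.log Real.pi - deriv Real.Gamma 1 := by
  have i1 : MeasureTheory.IntegrableOn hD (Set.Ioc 0 1) :=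
    hD_integrable.mono_set Set.Ioc_subset_Ioi_self
  have i2 : MeasureTheory.IntegrableOn hD (Set.Ioi 1) :=
    hD_integrable.mono_set (Set.Ioi_subset_Ioi zero_le_one)
  have hsplit : ∫ t in Set.Ioi 0, hD t
      = (∫ t in Set.Ioc 0 1, hD t) + ∫ t in Set.Ioi 1, hD t := by
    rw [← MeasureTheory.setIntegral_union Set.Ioc_disjoint_Ioi_same measurableSet_Ioi i1 i2,
      Set.Ioc_union_Ioi_eq_Ioi zero_le_one]
  rw [hD_integral] at hsplit
  have e1 : (∫ t in Set.Ioc (0:ℝ) 1,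
        ((1 + Real.exp (-2*t)) / (1 - Real.exp (-2*t)) - 1/t) / t)
      = (∫ t in Set.Ioc 0 1, hD t) + 2 / Real.pi * atI (1 / Real.pi) := by
    rw [← c_int.2, ← MeasureTheory.integral_add i1 c_int.1]
    refine MeasureTheory.setIntegral_congr_fun measurableSet_Ioc fun t _ => ?_
    simp only [hD]
    ring
  have e2 : (∫ t in Set.Ioi (1:ℝ), (2 * Real.exp (-2*t) / (1 - Real.exp (-2*t))) / t)
      = (∫ t in Set.Ioi 1, hD t)
        + (- Real.log Real.pi - 2 / Real.pi * atI (1 / Real.pi)) + 1 := by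
    rw [← c_int2.2, ← MeasureTheory.integral_add i2 c_int2.1]
    refine Eq.trans ?_ (congrArg (HAdd.hAdd _) sq_int.2)
    refine Eq.trans ?_ (MeasureTheory.integral_add (i2.add c_int2.1) sq_int.1)
    refine MeasureTheory.setIntegral_congr_fun measurableSet_Ioi fun t ht => ?_
    have ht : 0 < t := lt_trans one_pos ht
    have hexp : 1 - Real.exp (-2*t) ≠ 0 := by
      have : Real.exp (-2*t) < 1 := by rw [← Real.exp_zero]; exact Real.exp_lt_exp.2 (by linarith)
      linarith
    simp only [hD, Pi.add_apply]
    generalize Real.exp (-2*t) = E at *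
    generalize Real.arctan (t / Real.pi) = F at *
    field_simp
    ring
  have hg := Real.eulerMascheroniConstant_eq_neg_deriv
  rw [e1, e2]
  linarith
end

section
/- For every β with 0 < β ≤ π, the identity ∫_0^1 (sinh(2t)/(cosh(2t) - cos β)) dt/t + ∫_1^∞ (sinh(2t)/(cosh(2t) - cos β) - 1) dt/t = -log π - (1/2)(Γ'/Γ(β/(2π)) + Γ'/Γ(1 - β/(2π))) holds. -/
section AuxLemmas
open MeasureTheory Set Filter Topology

lemma aux_sum {F : ℕ → ℝ → ℝ} {f : ℝ → ℝ} {S : Set ℝ} (hS : MeasurableSet S)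
    (hF : ∀ n, IntegrableOn (F n) S) (hs : Summable fun n => ∫ t in S, ‖F n t‖)
    (hf : ∀ t ∈ S, HasSum (fun n => F n t) (f t)) :
    IntegrableOn f S ∧ HasSum (fun n => ∫ t in S, F n t) (∫ t in S, f t) := by
  have hae : ∀ᵐ t ∂(volume.restrict S), ∑' n, F n t = f t := by
    filter_upwards [ae_restrict_mem hS] with t ht using (hf t ht).tsum_eq
  have h1 := hasSum_integral_of_summable_integral_norm hF hs
  rw [integral_congr_ae hae] at h1
  refine ⟨⟨?_, ?_⟩, h1⟩
  · refine aestronglyMeasurable_of_tendsto_ae (u := atTop)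
      (f := fun N t => ∑ n ∈ Finset.range N, F n t) ?_ ?_
    · intro N
      exact (integrable_finsetSum _ (fun n _ => hF n)).1
    · filter_upwards [ae_restrict_mem hS] with t ht using (hf t ht).tendsto_sum_nat
  · unfold HasFiniteIntegral
    calc ∫⁻ t in S, ‖f t‖ₑ ≤ ∫⁻ t in S, ∑' n, ‖F n t‖ₑ := by
          apply lintegral_mono_ae
          filter_upwards [ae_restrict_mem hS] with t ht
          rw [← (hf t ht).tsum_eq]
          exact enorm_tsum_le_tsum_enorm
      _ = ∑' n, ∫⁻ t in S, ‖F n t‖ₑ := lintegral_tsum (fun n => (hF n).1.enorm)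
      _ = ∑' n, ENNReal.ofReal (∫ t in S, ‖F n t‖) := by
          congr 1; ext n
          rw [ofReal_integral_norm_eq_lintegral_enorm (hF n)]
      _ < ⊤ := by
          rw [← ENNReal.ofReal_tsum_of_nonneg (fun n => integral_nonneg (fun t => norm_nonneg _)) hs]
          exact ENNReal.ofReal_lt_top

lemma aux_reg {f g : ℝ → ℝ} (h1 : IntegrableOn (fun t => f t / t) (Ioc 0 1))
    (h2 : IntegrableOn (fun t => (f t - 1) / t) (Ioi 1))
    (h3 : IntegrableOn (fun t => (g t - f t) / t) (Ioi 0)) :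
    IntegrableOn (fun t => g t / t) (Ioc 0 1) ∧ IntegrableOn (fun t => (g t - 1) / t) (Ioi 1) ∧
    (∫ t in Ioc (0:ℝ) 1, g t / t) + (∫ t in Ioi (1:ℝ), (g t - 1) / t) =
    (∫ t in Ioc (0:ℝ) 1, f t / t) + (∫ t in Ioi (1:ℝ), (f t - 1) / t) +
      ∫ t in Ioi (0:ℝ), (g t - f t) / t := by
  have ha : IntegrableOn (fun t => (g t - f t) / t) (Ioc 0 1) := h3.mono_set Ioc_subset_Ioi_self
  have hb : IntegrableOn (fun t => (g t - f t) / t) (Ioi 1) :=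
    h3.mono_set (Ioi_subset_Ioi zero_le_one)
  have e1 : (fun t => g t / t) = (fun t => f t / t + (g t - f t) / t) := by ext t; ring
  have e2 : (fun t => (g t - 1) / t) = (fun t => (f t - 1) / t + (g t - f t) / t) := by
    ext t; ring
  have e3 : ∫ t in Ioi (0:ℝ), (g t - f t) / t = (∫ t in Ioc (0:ℝ) 1, (g t - f t) / t) +
      ∫ t in Ioi (1:ℝ), (g t - f t) / t := by
    rw [← setIntegral_union (Ioc_disjoint_Ioi le_rfl) measurableSet_Ioi ha hb,
      Ioc_union_Ioi_eq_Ioi zero_le_one]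
  refine ⟨by rw [e1]; exact h1.add ha, by rw [e2]; exact h2.add hb, ?_⟩
  rw [e1, e2, e3, integral_add h1 ha, integral_add h2 hb]
  ring

noncomputable def auxPsi (x : ℝ) : ℝ := deriv Real.Gamma x / Real.Gamma x

lemma auxPsi_eq {x : ℝ} (hx : 0 < x) : auxPsi x = deriv (Real.log ∘ Real.Gamma) x := by
  rw [Function.comp_def, deriv.log (Real.differentiableAt_Gamma (fun m ↦ by
    have : (0:ℝ) ≤ m := by positivity
    linarith)) (Real.Gamma_pos_of_pos hx).ne']
  rfl

lemma auxPsi_hder {x : ℝ} (hx : 0 < x) : DifferentiableAt ℝ (Real.log ∘ Real.Gamma) x := by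
  refine ((Real.differentiableAt_Gamma ?_).log (Real.Gamma_ne_zero ?_)) <;>
  · intro m
    have : (0:ℝ) ≤ m := by positivity
    linarith

lemma auxPsi_rec {x : ℝ} (hx : 0 < x) : auxPsi (x + 1) = auxPsi x + 1 / x := by
  rw [auxPsi_eq hx, auxPsi_eq (by linarith)]
  rw [← deriv_comp_add_const, one_div, ← Real.deriv_log,
      ← deriv_add (auxPsi_hder <| by positivity) (Real.differentiableAt_log hx.ne')]
  apply EventuallyEq.deriv_eq
  filter_upwards [eventually_gt_nhds hx] with y hy
  simp only [Function.comp_apply, Pi.add_apply,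
      Real.Gamma_add_one hy.ne', Real.log_mul hy.ne' (Real.Gamma_pos_of_pos hy).ne', add_comm]

lemma auxPsi_mono {x y : ℝ} (hx : 0 < x) (hxy : x ≤ y) : auxPsi x ≤ auxPsi y := by
  rcases hxy.eq_or_lt with rfl | h
  · rfl
  have hc := Real.convexOn_log_Gamma
  have hy : 0 < y := hx.trans h
  rw [auxPsi_eq hx, auxPsi_eq hy]
  exact (hc.deriv_le_slope hx hy h (auxPsi_hder hx)).trans
    (hc.slope_le_deriv hx hy h (auxPsi_hder hy))

lemma auxPsi_sum {x : ℝ} (hx : 0 < x) (N : ℕ) :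
    ∑ k ∈ Finset.range N, 1 / (k + x) = auxPsi (N + x) - auxPsi x := by
  induction N with
  | zero => simp
  | succ n ih =>
    rw [Finset.sum_range_succ, ih]
    have := auxPsi_rec (x := n + x) (by positivity)
    push_cast
    rw [show (n:ℝ) + 1 + x = n + x + 1 by ring, this]
    ring

lemma auxPsi_tend {x : ℝ} (hx : 0 < x) (hx1 : x < 1) :
    Tendsto (fun N : ℕ => ∑ k ∈ Finset.range N, (1 / (k + x) - 1 / (k + 1/2 : ℝ))) atTop
      (𝓝 (auxPsi (1/2) - auxPsi x)) := by
  have key : Tendsto (fun N : ℕ => auxPsi (N + x) - auxPsi (N + 1/2)) atTop (𝓝 0) := by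
    apply squeeze_zero_norm' (a := fun N : ℕ => 1 / (N:ℝ)) _ tendsto_one_div_atTop_nhds_zero_nat
    filter_upwards [eventually_gt_atTop 0] with N hN
    have hN : (0:ℝ) < N := by exact_mod_cast hN
    have h0 := auxPsi_rec hN
    have h1 := auxPsi_mono hN (show (N:ℝ) ≤ N + x by linarith)
    have h2 := auxPsi_mono hN (show (N:ℝ) ≤ N + 1/2 by linarith)
    have h3 := auxPsi_mono (by linarith) (show (N:ℝ) + x ≤ N + 1 by linarith)
    have h4 := auxPsi_mono (by linarith) (show (N:ℝ) + 1/2 ≤ N + 1 by linarith)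
    rw [Real.norm_eq_abs, abs_le]
    constructor <;> linarith
  have := key.add_const (auxPsi (1/2) - auxPsi x)
  rw [zero_add] at this
  refine this.congr (fun N => ?_)
  rw [Finset.sum_sub_distrib, auxPsi_sum hx, auxPsi_sum (by norm_num)]
  ring

lemma aux_lor {a : ℝ} (ha : 0 < a) :
    IntegrableOn (fun t : ℝ => 1 / (t^2 + (Real.pi * a)^2)) (Ioi 0) ∧
    ∫ t in Ioi (0:ℝ), 1 / (t^2 + (Real.pi * a)^2) = 1 / 2 * (1 / a) := by
  have hpi := Real.pi_pos
  set c := Real.pi * a with hc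
  have hc0 : 0 < c := by positivity
  have e : (fun t : ℝ => 1 / (t^2 + c^2)) = fun t => (c^2)⁻¹ * (1 + (c⁻¹ * t)^2)⁻¹ := by
    ext t
    have : t^2 + c^2 ≠ 0 := by positivity
    field_simp
    ring
  constructor
  · rw [e]
    exact ((integrable_inv_one_add_sq.comp_mul_left' (inv_ne_zero hc0.ne')).const_mul _).integrableOn
  · rw [e, integral_const_mul, integral_comp_mul_left_Ioi (fun t => (1 + t^2)⁻¹) 0 (inv_pos.2 hc0)]
    simp
    rw [hc]
    field_simp

lemma aux_D {a b : ℝ} (ha : 0 < a) (hb : 0 < b) :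
    IntegrableOn (fun t : ℝ => 1 / (t^2 + (Real.pi * a)^2) - 1 / (t^2 + (Real.pi * b)^2)) (Ioi 0) ∧
    ∫ t in Ioi (0:ℝ), (1 / (t^2 + (Real.pi * a)^2) - 1 / (t^2 + (Real.pi * b)^2))
      = 1 / 2 * (1 / a - 1 / b) ∧
    ∫ t in Ioi (0:ℝ), ‖1 / (t^2 + (Real.pi * a)^2) - 1 / (t^2 + (Real.pi * b)^2)‖
      = 1 / 2 * |1 / a - 1 / b| := by
  have hpi := Real.pi_pos
  obtain ⟨ia, ea⟩ := aux_lor ha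
  obtain ⟨ib, eb⟩ := aux_lor hb
  have hI : ∫ t in Ioi (0:ℝ), (1 / (t^2 + (Real.pi * a)^2) - 1 / (t^2 + (Real.pi * b)^2))
      = 1 / 2 * (1 / a - 1 / b) := by
    rw [integral_sub ia ib, ea, eb]; ring
  refine ⟨ia.sub ib, hI, ?_⟩
  rcases le_total a b with h | h
  · have h' : 1 / b ≤ 1 / a := one_div_le_one_div_of_le ha h
    rw [abs_of_nonneg (by linarith), ← hI]
    congr 1; ext t
    apply abs_of_nonneg
    rw [sub_nonneg]
    gcongr
  · have h' : 1 / a ≤ 1 / b := one_div_le_one_div_of_le hb h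
    rw [abs_of_nonpos (by linarith), mul_neg, ← hI, ← integral_neg]
    congr 1; ext t
    apply abs_of_nonpos
    rw [sub_nonpos]
    gcongr

lemma aux_summable {x : ℝ} (hx : 0 < x) (hx1 : x < 1) :
    Summable (fun n : ℕ => |1 / (n + x) - 1 / (n + 1/2 : ℝ)|) := by
  rw [← summable_nat_add_iff 1]
  have h := (summable_nat_add_iff 1).2 (Real.summable_one_div_nat_pow.2 (one_lt_two))
  refine Summable.of_nonneg_of_le (fun n => abs_nonneg _) (fun n => ?_) h
  have hn : (0:ℝ) < ((n + 1 : ℕ) : ℝ) := by positivity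
  set m := ((n + 1 : ℕ) : ℝ)
  rw [div_sub_div _ _ (by positivity) (by positivity), abs_div,
    abs_of_pos (show 0 < (m + x) * (m + 1/2) by positivity)]
  have : |1 * (m + 1/2) - (m + x) * 1| ≤ 1 := by rw [abs_le]; constructor <;> linarith
  gcongr
  nlinarith

lemma aux_cmp {x : ℝ} (hx : 0 < x) (hx1 : x < 1) {f : ℝ → ℝ}
    (hf : ∀ t ∈ Ioi (0:ℝ), HasSum (fun n : ℕ =>
      (1 / (t^2 + (Real.pi * (n + x))^2) - 1 / (t^2 + (Real.pi * (n + 1/2))^2)) +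
      (1 / (t^2 + (Real.pi * (n + (1 - x)))^2) - 1 / (t^2 + (Real.pi * (n + 1/2))^2))) (f t)) :
    IntegrableOn f (Ioi 0) ∧ ∫ t in Ioi (0:ℝ), f t =
      1/2 * (auxPsi (1/2) - auxPsi x) + 1/2 * (auxPsi (1/2) - auxPsi (1 - x)) := by
  have hy : 0 < 1 - x := by linarith
  have hy1 : 1 - x < 1 := by linarith
  have A := fun n : ℕ => aux_D (a := n + x) (b := n + 1/2) (by positivity) (by positivity)
  have B := fun n : ℕ => aux_D (a := n + (1 - x)) (b := n + 1/2) (by positivity) (by positivity)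
  obtain ⟨h1, h2⟩ := aux_sum measurableSet_Ioi (fun n => (A n).1.add (B n).1) (by
    refine Summable.of_nonneg_of_le (fun n => integral_nonneg (fun t => norm_nonneg _)) (fun n => ?_)
      (((aux_summable hx hx1).mul_left (1/2)).add ((aux_summable hy hy1).mul_left (1/2)))
    rw [← (A n).2.2, ← (B n).2.2, ← integral_add (A n).1.norm (B n).1.norm]
    apply integral_mono ((A n).1.add (B n).1).norm ((A n).1.norm.add (B n).1.norm)
    intro t
    exact norm_add_le _ _) hf
  refine ⟨h1, ?_⟩
  refine tendsto_nhds_unique h2.tendsto_sum_nat ?_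
  refine (((auxPsi_tend hx hx1).const_mul (1/2)).add ((auxPsi_tend hy hy1).const_mul (1/2))).congr
    (fun N => ?_)
  rw [Finset.mul_sum, Finset.mul_sum, ← Finset.sum_add_distrib]
  refine Finset.sum_congr rfl (fun n _ => ?_)
  rw [← (A n).2.1, ← (B n).2.1]
  exact (integral_add (A n).1 (B n).1).symm

lemma aux_cot_im (a b : ℝ) (hb : 0 < b) :
    (Complex.cot (a + b * Complex.I)).im
      = - (Real.sinh (2*b) / (Real.cosh (2*b) - Real.cos (2*a))) := by
  have hS : 0 < Real.sinh b := Real.sinh_pos_iff.2 hb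
  have h1 := Real.cosh_sq b
  have h2 := Real.sin_sq_add_cos_sq a
  have hs : Complex.sin (a + b * Complex.I) =
      ((Real.sin a * Real.cosh b : ℝ) : ℂ) + ((Real.cos a * Real.sinh b : ℝ) : ℂ) * Complex.I := by
    rw [Complex.sin_add_mul_I]; push_cast; ring
  have hc : Complex.cos (a + b * Complex.I) =
      ((Real.cos a * Real.cosh b : ℝ) : ℂ) + ((-(Real.sin a * Real.sinh b) : ℝ) : ℂ) * Complex.I := by
    rw [Complex.cos_add_mul_I]; push_cast; ring
  have hn : Complex.normSq (Complex.sin (a + b * Complex.I)) = Real.sinh b ^ 2 + Real.sin a ^ 2 := by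
    rw [hs, Complex.normSq_add_mul_I]
    rw [mul_pow, mul_pow, h1]
    linear_combination (Real.sinh b)^2 * h2
  have hd : Real.cosh (2*b) - Real.cos (2*a) = 2 * (Real.sinh b ^ 2 + Real.sin a ^ 2) := by
    rw [Real.cosh_two_mul, Real.cos_two_mul]
    linear_combination h1 - 2 * h2
  rw [Complex.cot, Complex.div_im, hn, hd, hs, hc, Real.sinh_two_mul]
  simp only [Complex.add_re, Complex.add_im, Complex.mul_re, Complex.mul_im, Complex.I_re,
    Complex.I_im, Complex.ofReal_re, Complex.ofReal_im]
  have : Real.sinh b ^ 2 + Real.sin a ^ 2 ≠ 0 := by positivity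
  field_simp
  linear_combination (-Real.cosh b * Real.sinh b) * h2

lemma aux_usum {x t : ℝ} (hx : 0 < x) :
    Summable (fun n : ℕ => 1 / (t^2 + (Real.pi * (n + x))^2)) := by
  rw [← summable_nat_add_iff 1]
  have h := (summable_nat_add_iff 1).2 (Real.summable_one_div_nat_pow.2 (one_lt_two))
  refine Summable.of_nonneg_of_le (fun n => by positivity) (fun n => ?_) h
  have hn : (0:ℝ) < ((n + 1 : ℕ) : ℝ) := by positivity
  set m := ((n + 1 : ℕ) : ℝ)
  have hpi := Real.pi_gt_three
  have : m ≤ Real.pi * (m + x) := by nlinarith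
  have h2 : m ^ 2 ≤ (Real.pi * (m + x)) ^ 2 := by gcongr
  gcongr
  nlinarith [sq_nonneg t]

lemma aux_inv_im (y t : ℝ) (ht : 0 < t) :
    (1 / ((y : ℂ) + ((t / Real.pi : ℝ) : ℂ) * Complex.I)).im
      = -(Real.pi * t) * (1 / (t^2 + (Real.pi * y)^2)) := by
  have hpi := Real.pi_pos
  rw [one_div, Complex.inv_im, Complex.normSq_add_mul_I]
  simp
  have : t ^ 2 + (Real.pi * y)^2 ≠ 0 := by positivity
  have : y ^ 2 + (t / Real.pi)^2 ≠ 0 := by positivity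
  field_simp
  ring

lemma aux_pt {x t : ℝ} (hx : 0 < x) (hx1 : x < 1) (ht : 0 < t) :
    HasSum (fun n : ℕ => 1 / (t^2 + (Real.pi * (n + x))^2)
      + 1 / (t^2 + (Real.pi * (n + (1 - x)))^2))
      (Real.sinh (2*t) / (Real.cosh (2*t) - Real.cos (2 * (Real.pi * x))) / t) := by
  have hpi := Real.pi_pos
  set z : ℂ := (x : ℂ) + ((t / Real.pi : ℝ) : ℂ) * Complex.I with hz
  have hzim : z.im = t / Real.pi := by simp [hz]
  have hzc : z ∈ Complex.integerComplement := by
    rintro ⟨n, hn⟩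
    have := congrArg Complex.im hn
    rw [hzim] at this
    have h0 : 0 < t / Real.pi := by positivity
    simp only [Complex.intCast_im] at this
    linarith
  have h1 := (summable_cotTerm hzc).hasSum
  rw [show ∑' n, cotTerm z n = _ from (cot_series_rep' hzc).symm] at h1
  have h2 := Complex.imCLM.hasSum h1
  simp only [Complex.imCLM_apply] at h2
  have e1 : ∀ n : ℕ, (cotTerm z n).im = -(Real.pi * t) * (1 / (t^2 + (Real.pi * (n + (1 - x)))^2) +
      1 / (t^2 + (Real.pi * ((n + 1 : ℕ) + x))^2)) := by
    intro n
    have a1 := aux_inv_im (x - (n + 1)) t ht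
    have a2 := aux_inv_im (x + (n + 1)) t ht
    rw [cotTerm, Complex.add_im]
    have b1 : z - (n + 1) = ((x - (n + 1) : ℝ) : ℂ) + ((t / Real.pi : ℝ) : ℂ) * Complex.I := by
      rw [hz]; push_cast; ring
    have b2 : z + (n + 1) = ((x + (n + 1) : ℝ) : ℂ) + ((t / Real.pi : ℝ) : ℂ) * Complex.I := by
      rw [hz]; push_cast; ring
    rw [b1, b2, a1, a2]
    push_cast
    ring_nf
  have e2 : (Real.pi * Complex.cot (Real.pi * z) - 1 / z).im =
      -(Real.pi) * (Real.sinh (2*t) / (Real.cosh (2*t) - Real.cos (2 * (Real.pi * x)))) +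
       (Real.pi * t) * (1 / (t^2 + (Real.pi * x)^2)) := by
    rw [Complex.sub_im, hz, aux_inv_im x t ht, Complex.im_ofReal_mul]
    have : (Real.pi : ℂ) * ((x : ℂ) + ((t / Real.pi : ℝ) : ℂ) * Complex.I) =
        ((Real.pi * x : ℝ) : ℂ) + (t : ℂ) * Complex.I := by
      have : (Real.pi : ℂ) ≠ 0 := by exact_mod_cast hpi.ne'
      push_cast
      field_simp
    rw [this, aux_cot_im _ _ ht]
    ring
  simp only [e1] at h2
  rw [e2] at h2
  have hv := aux_usum (x := 1 - x) (t := t) (by linarith)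
  have hu := aux_usum (x := x) (t := t) hx
  have hu' := (summable_nat_add_iff 1).2 hu
  have h3 := ((hv.hasSum.add hu'.hasSum).mul_left (-(Real.pi * t))).unique h2
  have h4 := hu.tsum_eq_zero_add
  convert hu.hasSum.add hv.hasSum using 1
  rw [h4]
  simp only [Nat.cast_zero, zero_add]
  have : Real.pi * t ≠ 0 := by positivity
  apply mul_left_cancel₀ this
  have : Real.pi * t * (Real.sinh (2*t) / (Real.cosh (2*t) - Real.cos (2 * (Real.pi * x))) / t) =
    Real.pi * (Real.sinh (2*t) / (Real.cosh (2*t) - Real.cos (2 * (Real.pi * x)))) := by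
    field_simp
  rw [this]
  linear_combination (1 : ℝ) * h3

lemma aux_main1 {x : ℝ} (hx : 0 < x) (hx1 : x < 1) :
    IntegrableOn (fun t => (Real.sinh (2*t) / (Real.cosh (2*t) - Real.cos (2 * (Real.pi * x))) -
      Real.sinh (2*t) / (Real.cosh (2*t) - Real.cos (2 * (Real.pi * (1/2))))) / t) (Ioi 0) ∧
    ∫ t in Ioi (0:ℝ), (Real.sinh (2*t) / (Real.cosh (2*t) - Real.cos (2 * (Real.pi * x))) -
      Real.sinh (2*t) / (Real.cosh (2*t) - Real.cos (2 * (Real.pi * (1/2))))) / t =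
      1/2 * (auxPsi (1/2) - auxPsi x) + 1/2 * (auxPsi (1/2) - auxPsi (1 - x)) := by
  apply aux_cmp hx hx1
  intro t ht
  have h1 := aux_pt hx hx1 ht
  have h2 := aux_pt (x := 1/2) (by norm_num) (by norm_num) ht
  rw [sub_div]
  have e : (fun n : ℕ =>
      (1 / (t^2 + (Real.pi * (n + x))^2) - 1 / (t^2 + (Real.pi * (n + 1/2))^2)) +
      (1 / (t^2 + (Real.pi * (n + (1 - x)))^2) - 1 / (t^2 + (Real.pi * (n + 1/2))^2))) =
      fun n : ℕ => (1 / (t^2 + (Real.pi * (n + x))^2) + 1 / (t^2 + (Real.pi * (n + (1 - x)))^2)) -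
      (1 / (t^2 + (Real.pi * (n + 1/2))^2) + 1 / (t^2 + (Real.pi * (n + (1 - 1/2)))^2)) := by
    funext n
    rw [show (1:ℝ) - 1/2 = 1/2 by norm_num]
    ring
  rw [e]
  exact h1.sub h2

lemma aux_frul {a b : ℝ} (ha : 0 < a) (hab : a ≤ b) :
    IntegrableOn (fun t : ℝ => (Real.exp (-(a * t)) - Real.exp (-(b * t))) / t) (Ioi 0) ∧
    ∫ t in Ioi (0:ℝ), (Real.exp (-(a * t)) - Real.exp (-(b * t))) / t = Real.log (b / a) := by
  have hint : IntegrableOn (fun t : ℝ => (Real.exp (-(a * t)) - Real.exp (-(b * t))) / t) (Ioi 0) := by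
    refine Integrable.mono' ((exp_neg_integrableOn_Ioi 0 ha).const_mul (b - a)) ?_ ?_
    · exact Measurable.aestronglyMeasurable (by fun_prop)
    · filter_upwards [ae_restrict_mem measurableSet_Ioi] with t ht
      have ht : 0 < t := ht
      have h1 : Real.exp (-(b * t)) ≤ Real.exp (-(a * t)) := by
        apply Real.exp_le_exp.2; nlinarith
      rw [Real.norm_eq_abs, abs_of_nonneg (div_nonneg (by linarith) ht.le), div_le_iff₀ ht]
      have h2 : Real.exp (-(b * t)) = Real.exp (-(a * t)) * Real.exp (-((b - a) * t)) := by
        rw [← Real.exp_add]; ring_nf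
      have h3 := Real.add_one_le_exp (-((b - a) * t))
      rw [h2, neg_mul]
      have := Real.exp_pos (-(a * t))
      nlinarith
  refine ⟨hint, ?_⟩
  have e : (fun t : ℝ => (Real.exp (-(a * t)) - Real.exp (-(b * t))) / t) =
      fun t => t⁻¹ • ((fun u => Real.exp (-u)) (a * t) - (fun u => Real.exp (-u)) (b * t)) := by
    ext t; simp [div_eq_inv_mul]
  have hc : Continuous (fun u : ℝ => Real.exp (-u)) := by fun_prop
  have hL : Tendsto (fun u : ℝ => Real.exp (-u)) (𝓝[>] 0) (𝓝 1) := by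
    have := hc.tendsto 0
    simp only [neg_zero, Real.exp_zero] at this
    exact this.mono_left nhdsWithin_le_nhds
  rw [e] at hint ⊢
  rw [Frullani.integral_Ioi_eq (L := 1) (R := 0)
    (hc.continuousOn.locallyIntegrableOn measurableSet_Ioi) ha (ha.trans_le hab) hL
    Real.tendsto_exp_neg_atTop_nhds_zero hint]
  simp

lemma aux_wallis :
    IntegrableOn (fun t : ℝ => Real.exp (-(2*t)) * (1 - Real.exp (-(2*t))) /
      (1 + Real.exp (-(2*t))) / t) (Ioi 0) ∧
    ∫ t in Ioi (0:ℝ), Real.exp (-(2*t)) * (1 - Real.exp (-(2*t))) /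
      (1 + Real.exp (-(2*t))) / t = Real.log (Real.pi / 2) := by
  have A := fun j : ℕ => aux_frul (a := 4*j+2) (b := 4*j+4) (by positivity) (by linarith)
  have B := fun j : ℕ => aux_frul (a := 4*j+4) (b := 4*j+6) (by positivity) (by linarith)
  set F : ℕ → ℝ → ℝ := fun j t => (Real.exp (-((4*j+2) * t)) - Real.exp (-((4*j+4) * t))) / t -
    (Real.exp (-((4*j+4) * t)) - Real.exp (-((4*j+6) * t))) / t with hF
  have hFi : ∀ j, IntegrableOn (F j) (Ioi 0) := fun j => (A j).1.sub (B j).1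
  have hFe : ∀ j t, F j t = (Real.exp (-(2*t)) ^ 2) ^ j *
      (Real.exp (-(2*t)) * (1 - Real.exp (-(2*t)))^2 / t) := by
    intro j t
    have e1 : Real.exp (-((4*j+2) * t)) = (Real.exp (-(2*t)) ^ 2) ^ j * Real.exp (-(2*t)) := by
      rw [← pow_mul, ← Real.exp_nat_mul, ← Real.exp_add]; push_cast; ring_nf
    have e2 : Real.exp (-((4*j+4) * t)) = (Real.exp (-(2*t)) ^ 2) ^ j * Real.exp (-(2*t)) ^ 2 := by
      rw [← pow_mul, ← pow_add, ← Real.exp_nat_mul]; push_cast; ring_nf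
    have e3 : Real.exp (-((4*j+6) * t)) = (Real.exp (-(2*t)) ^ 2) ^ j * Real.exp (-(2*t)) ^ 3 := by
      rw [← pow_mul, ← pow_add, ← Real.exp_nat_mul]; push_cast; ring_nf
    simp only [hF]
    rw [e1, e2, e3]
    ring
  have hint : ∀ j : ℕ, ∫ t in Ioi (0:ℝ), F j t =
      Real.log ((2 * j + 2) / (2 * j + 1) * ((2 * j + 2) / (2 * j + 3))) := by
    intro j
    simp only [hF]
    rw [integral_sub (A j).1 (B j).1, (A j).2, (B j).2, ← Real.log_div (by positivity) (by positivity)]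
    congr 1
    field_simp
    ring
  have hnn : ∀ j, ∀ t ∈ Ioi (0:ℝ), 0 ≤ F j t := by
    intro j t ht
    have ht : 0 < t := ht
    rw [hFe]
    positivity
  have hnorm : ∀ j, ∫ t in Ioi (0:ℝ), ‖F j t‖ = ∫ t in Ioi (0:ℝ), F j t := by
    intro j
    apply setIntegral_congr_fun measurableSet_Ioi
    intro t ht
    exact abs_of_nonneg (hnn j t ht)
  have hsum : HasSum (fun j : ℕ => ∫ t in Ioi (0:ℝ), F j t) (Real.log (Real.pi / 2)) := by
    rw [hasSum_iff_tendsto_nat_of_nonneg (fun j => setIntegral_nonneg measurableSet_Ioi (hnn j))]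
    refine ((Real.continuousAt_log (by positivity)).tendsto.comp Real.tendsto_prod_pi_div_two).congr
      (fun N => ?_)
    rw [Function.comp_apply, Real.log_prod (fun i _ => by positivity)]
    exact Finset.sum_congr rfl (fun j _ => (hint j).symm)
  obtain ⟨h1, h2⟩ := aux_sum (f := fun t : ℝ => Real.exp (-(2*t)) * (1 - Real.exp (-(2*t))) /
      (1 + Real.exp (-(2*t))) / t) measurableSet_Ioi hFi (by simp only [hnorm]; exact hsum.summable) (by
    intro t ht
    have ht : 0 < t := ht
    simp only [hFe]
    have hq0 := Real.exp_pos (-(2*t))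
    have hq1 : Real.exp (-(2*t)) < 1 := by rw [Real.exp_lt_one_iff]; linarith
    set q := Real.exp (-(2*t))
    have hg := (hasSum_geometric_of_lt_one (r := q^2) (by positivity) (by nlinarith)).mul_right
      (q * (1 - q)^2 / t)
    have h1 : 1 - q ≠ 0 := by linarith
    have h3 : 1 + q ≠ 0 := by linarith
    have h4 : (1 - q^2)⁻¹ * (q * (1 - q)^2 / t) = q * (1 - q) / (1 + q) / t := by
      rw [show 1 - q^2 = (1 - q) * (1 + q) by ring]
      field_simp
    rw [h4] at hg
    exact hg)
  exact ⟨h1, h2.unique hsum⟩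

lemma aux_tanh :
    IntegrableOn (fun t : ℝ => (Real.sinh (2*t) / (Real.cosh (2*t) -
      Real.cos (2 * (Real.pi * (1/2)))) - (1 - Real.exp (-t))) / t) (Ioi 0) ∧
    ∫ t in Ioi (0:ℝ), (Real.sinh (2*t) / (Real.cosh (2*t) -
      Real.cos (2 * (Real.pi * (1/2)))) - (1 - Real.exp (-t))) / t
      = Real.log 2 - Real.log (Real.pi / 2) := by
  have A := aux_frul (a := 1) (b := 2) (by norm_num) (by norm_num)
  have B := aux_wallis
  have e : EqOn (fun t : ℝ => (Real.sinh (2*t) / (Real.cosh (2*t) -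
      Real.cos (2 * (Real.pi * (1/2)))) - (1 - Real.exp (-t))) / t)
      (fun t => (Real.exp (-(1 * t)) - Real.exp (-(2 * t))) / t - Real.exp (-(2*t)) *
        (1 - Real.exp (-(2*t))) / (1 + Real.exp (-(2*t))) / t) (Ioi 0) := by
    intro t ht
    have ht : 0 < t := ht
    have h1 : Real.cos (2 * (Real.pi * (1/2))) = -1 := by
      rw [show 2 * (Real.pi * (1/2)) = Real.pi by ring, Real.cos_pi]
    have hq0 := Real.exp_pos (-(2*t))
    simp only [h1, one_mul]
    rw [Real.sinh_eq, Real.cosh_eq, show Real.exp (2*t) = (Real.exp (-(2*t)))⁻¹ by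
      rw [← Real.exp_neg, neg_neg]]
    set q := Real.exp (-(2*t))
    have : (q⁻¹ - q) / 2 / ((q⁻¹ + q) / 2 - -1) = (1 - q) / (1 + q) := by
      have e1 : (q⁻¹ - q) / 2 = (1 - q) * (1 + q) / (2 * q) := by field_simp; ring
      have e2 : (q⁻¹ + q) / 2 - -1 = (1 + q) * (1 + q) / (2 * q) := by field_simp; ring
      rw [e1, e2]
      field_simp
    rw [this]
    field_simp
    ring
  refine ⟨(A.1.sub B.1).congr_fun e.symm measurableSet_Ioi, ?_⟩
  rw [setIntegral_congr_fun measurableSet_Ioi e, integral_sub A.1 B.1, A.2, B.2, div_one]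

lemma aux_log1 : IntegrableOn (fun t : ℝ => Real.log t * Real.exp (-t)) (Ioc 0 1) := by
  have h := (intervalIntegrable_iff_integrableOn_Ioc_of_le zero_le_one).1
    (intervalIntegral.intervalIntegrable_log' (a := 0) (b := 1))
  refine Integrable.mono h (Measurable.aestronglyMeasurable (by fun_prop)) ?_
  filter_upwards [ae_restrict_mem measurableSet_Ioc] with t ht
  have h2 : Real.exp (-t) ≤ 1 := by rw [Real.exp_le_one_iff]; linarith [ht.1]
  rw [norm_mul, Real.norm_eq_abs (Real.exp (-t)), abs_of_pos (Real.exp_pos _)]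
  exact mul_le_of_le_one_right (norm_nonneg _) h2

lemma aux_log2 : IntegrableOn (fun t : ℝ => Real.log t * Real.exp (-t)) (Ioi 1) := by
  have h := (Real.GammaIntegral_convergent (s := 2) (by norm_num)).mono_set
    (Ioi_subset_Ioi zero_le_one)
  refine Integrable.mono' h (Measurable.aestronglyMeasurable (by fun_prop)) ?_
  filter_upwards [ae_restrict_mem measurableSet_Ioi] with t ht
  have ht : 1 < t := ht
  have h1 := Real.log_nonneg ht.le
  have h2 := Real.log_le_self (show 0 ≤ t by linarith)
  have h3 := Real.exp_pos (-t)
  rw [Real.norm_eq_abs, abs_of_nonneg (by positivity), show (2:ℝ) - 1 = 1 by norm_num, Real.rpow_one]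
  nlinarith

lemma aux_log3 : ∫ t in Ioi (0:ℝ), Real.log t * Real.exp (-t) = auxPsi 1 := by
  have h1 := Complex.hasDerivAt_GammaIntegral (s := 1) (by simp)
  have h2 : HasDerivAt Complex.GammaIntegral (-(Real.eulerMascheroniConstant : ℂ)) 1 := by
    refine Complex.hasDerivAt_Gamma_one.congr_of_eventuallyEq ?_
    have : ∀ᶠ s : ℂ in 𝓝 1, 0 < s.re :=
      Complex.continuous_re.continuousAt.eventually (lt_mem_nhds (by simp))
    filter_upwards [this] with s hs using (Complex.Gamma_eq_integral hs).symm
  have h3 := h1.unique h2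
  have h4 : auxPsi 1 = - Real.eulerMascheroniConstant := by
    rw [auxPsi, Real.hasDerivAt_Gamma_one.deriv, Real.Gamma_one, div_one]
  rw [h4]
  have h5 : ∫ t in Ioi (0:ℝ), (t : ℂ) ^ ((1:ℂ) - 1) * (Real.log t * Real.exp (-t)) =
      ((∫ t in Ioi (0:ℝ), Real.log t * Real.exp (-t) : ℝ) : ℂ) := by
    rw [← integral_complex_ofReal]
    congr 1; ext t
    simp
  rw [h5] at h3
  exact_mod_cast h3

lemma aux_g1 : IntegrableOn (fun t : ℝ => (1 - Real.exp (-t)) / t) (Ioc 0 1) := by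
  refine Integrable.mono' (integrableOn_const (C := (1:ℝ)) (by simp))
    (Measurable.aestronglyMeasurable (by fun_prop)) ?_
  filter_upwards [ae_restrict_mem measurableSet_Ioc] with t ht
  have h1 := Real.add_one_le_exp (-t)
  have h2 : Real.exp (-t) ≤ 1 := by rw [Real.exp_le_one_iff]; linarith [ht.1]
  rw [Real.norm_eq_abs, abs_of_nonneg (div_nonneg (by linarith) ht.1.le), div_le_iff₀ ht.1]
  linarith

lemma aux_g2 : IntegrableOn (fun t : ℝ => (1 - Real.exp (-t) - 1) / t) (Ioi 1) := by
  refine Integrable.mono' (exp_neg_integrableOn_Ioi 1 one_pos)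
    (Measurable.aestronglyMeasurable (by fun_prop)) ?_
  filter_upwards [ae_restrict_mem measurableSet_Ioi] with t ht
  have ht : 1 < t := ht
  have h3 := Real.exp_pos (-t)
  rw [Real.norm_eq_abs, show 1 - Real.exp (-t) - 1 = -Real.exp (-t) by ring, abs_div, abs_neg,
    abs_of_pos h3, abs_of_pos (by linarith), neg_mul, one_mul, div_le_iff₀ (by linarith)]
  nlinarith

lemma aux_gamma : (∫ t in Ioc (0:ℝ) 1, (1 - Real.exp (-t)) / t) +
    (∫ t in Ioi (1:ℝ), (1 - Real.exp (-t) - 1) / t) = - auxPsi 1 := by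
  have hd : ∀ t : ℝ, HasDerivAt (fun t : ℝ => Real.exp (-t)) (-Real.exp (-t)) t := by
    intro t
    simpa using (hasDerivAt_neg t).exp
  have k1 : ∫ t in Ioc (0:ℝ) 1, ((1 - Real.exp (-t)) / t + Real.log t * Real.exp (-t)) = 0 := by
    rw [← intervalIntegral.integral_of_le zero_le_one]
    rw [intervalIntegral.integral_eq_sub_of_hasDerivAt_of_tendsto
      (f := fun t => Real.log t * (1 - Real.exp (-t))) (fa := 0) (fb := 0) one_pos]
    · simp
    · intro t ht
      have := (Real.hasDerivAt_log ht.1.ne').mul ((hd t).const_sub 1)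
      convert! this using 1
      ring
    · exact (intervalIntegrable_iff_integrableOn_Ioc_of_le zero_le_one).2 (aux_g1.add aux_log1)
    · have h := tendsto_log_mul_rpow_nhdsGT_zero (r := 1) one_pos
      refine squeeze_zero_norm' (a := fun t => |Real.log t * t ^ (1:ℝ)|) ?_ (by simpa using h.abs)
      filter_upwards [self_mem_nhdsWithin] with t ht
      have ht : 0 < t := ht
      have h1 := Real.add_one_le_exp (-t)
      have h2 : Real.exp (-t) ≤ 1 := by rw [Real.exp_le_one_iff]; linarith
      rw [Real.norm_eq_abs, abs_mul, abs_mul, Real.rpow_one, abs_of_pos ht,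
        abs_of_nonneg (by linarith : 0 ≤ 1 - Real.exp (-t))]
      gcongr
      linarith
    · have : ContinuousAt (fun t => Real.log t * (1 - Real.exp (-t))) 1 :=
        (Real.continuousAt_log one_ne_zero).mul (by fun_prop)
      have := this.tendsto
      simp only [Real.log_one, zero_mul] at this
      exact this.mono_left nhdsWithin_le_nhds
  have k2 : ∫ t in Ioi (1:ℝ), ((1 - Real.exp (-t) - 1) / t + Real.log t * Real.exp (-t)) = 0 := by
    rw [integral_Ioi_of_hasDerivAt_of_tendsto'
      (f := fun t => -(Real.log t * Real.exp (-t)))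
      (f' := fun t => (1 - Real.exp (-t) - 1) / t + Real.log t * Real.exp (-t))
      (m := 0) ?_ (aux_g2.add aux_log2)]
    · simp
    · refine squeeze_zero_norm' (a := fun t => t ^ 1 * Real.exp (-t)) ?_
        (Real.tendsto_pow_mul_exp_neg_atTop_nhds_zero 1)
      filter_upwards [eventually_gt_atTop 1] with t ht
      have h1 := Real.log_nonneg ht.le
      have h2 := Real.log_le_self (show 0 ≤ t by linarith)
      rw [norm_neg, Real.norm_eq_abs, abs_of_nonneg (by positivity), pow_one]
      gcongr
    · intro t ht
      have ht : 1 ≤ t := ht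
      have := ((Real.hasDerivAt_log (show t ≠ 0 by linarith)).mul (hd t)).neg
      convert! this using 1
      ring
  rw [integral_add aux_g1 aux_log1] at k1
  rw [integral_add aux_g2 aux_log2] at k2
  have k3 := aux_log3
  rw [← Ioc_union_Ioi_eq_Ioi zero_le_one, setIntegral_union (Ioc_disjoint_Ioi le_rfl)
    measurableSet_Ioi aux_log1 aux_log2] at k3
  linarith

lemma aux_half : auxPsi (1/2) = auxPsi 1 - 2 * Real.log 2 := by
  rw [auxPsi, auxPsi, Real.hasDerivAt_Gamma_one.deriv, Real.hasDerivAt_Gamma_one_half.deriv,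
    Real.Gamma_one, Real.Gamma_one_half_eq]
  have : √Real.pi ≠ 0 := by positivity
  field_simp
  ring


end AuxLemmas


/-- for 0 < β ≤ π,
∫_0^1 (sinh(2t)/(cosh(2t)-cos β)) dt/t + ∫_1^∞ (sinh(2t)/(cosh(2t)-cos β) - 1) dt/t
  = -log π - (1/2)(Γ'/Γ(β/2π) + Γ'/Γ(1-β/2π)). -/
theorem stmt_6 (β : ℝ) (hβ0 : 0 < β) (hβπ : β ≤ Real.pi) :
    (∫ t in Set.Ioc (0:ℝ) 1,
        (Real.sinh (2*t) / (Real.cosh (2*t) - Real.cos β)) / t)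
      + (∫ t in Set.Ioi (1:ℝ),
          (Real.sinh (2*t) / (Real.cosh (2*t) - Real.cos β) - 1) / t)
      = - Real.log Real.pi
        - (1/2) * (deriv Real.Gamma (β/(2*Real.pi)) / Real.Gamma (β/(2*Real.pi))
            + deriv Real.Gamma (1 - β/(2*Real.pi)) / Real.Gamma (1 - β/(2*Real.pi))) := by
  have hpi := Real.pi_pos
  set x := β / (2 * Real.pi) with hx
  have hx0 : 0 < x := by positivity
  have hx1 : x < 1 := by
    rw [hx, div_lt_one (by positivity)]; linarith
  have hb : β = 2 * (Real.pi * x) := by rw [hx]; field_simp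
  obtain ⟨t1, t2⟩ := aux_tanh
  obtain ⟨r1, r2, r3⟩ := aux_reg aux_g1 aux_g2 t1
  obtain ⟨m1, m2⟩ := aux_main1 hx0 hx1
  obtain ⟨-, -, s3⟩ := aux_reg r1 r2 m1
  rw [← hb] at s3 m2
  have h1 := aux_gamma
  have h2 := aux_half
  have h3 : Real.log (Real.pi / 2) = Real.log Real.pi - Real.log 2 :=
    Real.log_div hpi.ne' two_ne_zero
  have h4 : deriv Real.Gamma x / Real.Gamma x = auxPsi x := rfl
  have h5 : deriv Real.Gamma (1 - x) / Real.Gamma (1 - x) = auxPsi (1 - x) := rfl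
  rw [h4, h5, s3, r3, m2, t2]
  linarith
end
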